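/- Set G = 0, let c ∈ ℝ, and let V = (−a·c·k₁, 0, −2ε₁a²c, 0) ∈ 𝒫⁴ (the null localized induction equation field). Then V ∈ 𝔛* with ρ_V = 0, and the induced curvature flow is the (rescaled) Hirota–Satsuma coupled KdV system: V̂(k₁) = c·(k₁‴ + 3a·k₁k₁′ + 6ε₁ε₂·a·k₂k₂′) and V̂(k₂) = −c·(2k₂‴ + 3a·k₁k₂′). -/

import Mathlib

noncomputable section
open MvPolynomial

/-- The differential algebra `𝒫`: polynomials in `k₁⁽ᵐ⁾ = X (0, m)` and `k₂⁽ᵐ⁾ = X (1, m)`. -/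
abbrev PP : Type := MvPolynomial (Fin 2 × ℕ) ℝ

/-- The derivation `f ↦ f′` with `D (kᵢ⁽ᵐ⁾) = kᵢ⁽ᵐ⁺¹⁾`. -/
def Dx : Derivation ℝ PP PP :=
  MvPolynomial.mkDerivation ℝ (fun im : Fin 2 × ℕ => MvPolynomial.X (im.1, im.2 + 1))

def k1 : PP := MvPolynomial.X (0, 0)
def k2 : PP := MvPolynomial.X (1, 0)

/-- A `𝒫`-local vector field: a quadruple `(f, h, g, l) ∈ 𝒫⁴`. -/
structure LVF where
  f : PP
  h : PP
  g : PP
  l : PP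

namespace LVF

instance : Zero LVF := ⟨⟨0, 0, 0, 0⟩⟩
instance : Neg LVF := ⟨fun U => ⟨-U.f, -U.h, -U.g, -U.l⟩⟩
instance : Add LVF := ⟨fun U W => ⟨U.f + W.f, U.h + W.h, U.g + W.g, U.l + W.l⟩⟩
instance : Sub LVF := ⟨fun U W => ⟨U.f - W.f, U.h - W.h, U.g - W.g, U.l - W.l⟩⟩

def phi (a ε₁ : ℝ) (V : LVF) : PP := C a * V.f + Dx V.h - C ε₁ * k1 * V.g

def psi (ε₂ : ℝ) (V : LVF) : PP := Dx V.l + C ε₂ * k2 * V.g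

def rho (a ε₁ : ℝ) (V : LVF) : PP :=
  - C a * Dx V.f + C (2 * a) * k1 * V.h - C a * k2 * V.l
    - Dx (phi a ε₁ V) + C ε₁ * k1 * Dx V.g

/-- Membership in `𝔛*`: `g_V′ = −ε₁·a·h_V`. -/
def isStar (a ε₁ : ℝ) (V : LVF) : Prop := Dx V.g = - C (ε₁ * a) * V.h

def alpha (a ε₁ : ℝ) (V : LVF) : PP :=
  C (1 / a) * (Dx (phi a ε₁ V) + C (1 / 2) * rho a ε₁ V)

def beta (a ε₁ ε₂ G : ℝ) (V : LVF) : PP :=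
  C (1 / a) * (Dx (alpha a ε₁ V) + k1 * phi a ε₁ V - k2 * psi ε₂ V - C G * V.g)

def delta (a ε₁ ε₂ : ℝ) (V : LVF) : PP :=
  C (1 / a) * Dx (Dx (psi ε₂ V)) + k1 * psi ε₂ V + C (ε₁ * ε₂) * k2 * phi a ε₁ V

/-- The value `V̂(k₁)`. -/
def vk1 (a ε₁ ε₂ G : ℝ) (V : LVF) : PP :=
  C (1 / a ^ 2) * Dx (Dx (Dx (phi a ε₁ V)))
    + C (1 / a) * (Dx (k1 * phi a ε₁ V) + k1 * Dx (phi a ε₁ V))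
    - C (1 / a) * (Dx (k2 * psi ε₂ V) + k2 * Dx (psi ε₂ V))
    + C (1 / a) * (C (1 / (2 * a)) * Dx (Dx (rho a ε₁ V)) + k1 * rho a ε₁ V
        - C (2 * G) * Dx V.g)

/-- The value `V̂(k₂)`. -/
def vk2 (a ε₁ ε₂ G : ℝ) (V : LVF) : PP :=
  C (ε₁ * ε₂ / a ^ 2) * Dx (Dx (Dx (psi ε₂ V)))
    + C (ε₁ * ε₂ / a) * (Dx (k1 * psi ε₂ V) + k1 * Dx (psi ε₂ V))
    + C (1 / a) * (Dx (k2 * phi a ε₁ V) + k2 * Dx (phi a ε₁ V))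
    + C (1 / a) * (k2 * rho a ε₁ V) - C (ε₂ * G) * V.l

/-- Values of `V̂` on the generators, defined by the recursion
`V̂(kᵢ⁽ᵐ⁺¹⁾) = (V̂(kᵢ⁽ᵐ⁾))′ + (1/(2a))·ρ_V·kᵢ⁽ᵐ⁺¹⁾`. -/
def vhatFun (a ε₁ ε₂ G : ℝ) (V : LVF) : Fin 2 × ℕ → PP := fun im =>
  Nat.rec (motive := fun _ => PP)
    (if im.1 = 0 then vk1 a ε₁ ε₂ G V else vk2 a ε₁ ε₂ G V)
    (fun m prev => Dx prev + C (1 / (2 * a)) * rho a ε₁ V * MvPolynomial.X (im.1, m + 1))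
    im.2

/-- The derivation `V̂` attached to `V ∈ 𝔛*`. -/
def vhat (a ε₁ ε₂ G : ℝ) (V : LVF) : Derivation ℝ PP PP :=
  MvPolynomial.mkDerivation ℝ (vhatFun a ε₁ ε₂ G V)

/-- The operator `D_V U`. -/
def DV (a ε₁ ε₂ G : ℝ) (V U : LVF) : LVF where
  f := vhat a ε₁ ε₂ G V U.f - alpha a ε₁ V * U.f - beta a ε₁ ε₂ G V * U.h
        + C (ε₁ * ε₂ / a) * delta a ε₁ ε₂ V * U.l
  h := vhat a ε₁ ε₂ G V U.h + phi a ε₁ V * U.f - C ε₁ * beta a ε₁ ε₂ G V * U.g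
        - C (ε₁ * ε₂ / a) * Dx (psi ε₂ V) * U.l
  g := vhat a ε₁ ε₂ G V U.g + C ε₁ * phi a ε₁ V * U.h + alpha a ε₁ V * U.g
        + C ε₂ * psi ε₂ V * U.l
  l := vhat a ε₁ ε₂ G V U.l + psi ε₂ V * U.f + C (1 / a) * Dx (psi ε₂ V) * U.h
        + C (ε₁ / a) * delta a ε₁ ε₂ V * U.g

/-- The bracket `[V₁, V₂] = D_{V₁}V₂ − D_{V₂}V₁`. -/
def bracket (a ε₁ ε₂ G : ℝ) (V₁ V₂ : LVF) : LVF :=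
  DV a ε₁ ε₂ G V₁ V₂ - DV a ε₁ ε₂ G V₂ V₁

end LVF

/-- The field generating the null localized induction equation:
`V = −a c k₁ T − 2ε₁a²c N`. -/
def NLIE (a ε₁ c : ℝ) : LVF :=
  ⟨- MvPolynomial.C (a * c) * k1, 0, - MvPolynomial.C (2 * ε₁ * a ^ 2 * c), 0⟩

theorem Dx_C (r : ℝ) : Dx (C r) = 0 := by
  simp [Dx]

theorem Dx_C_mul (r : ℝ) (p : PP) : Dx (C r * p) = C r * Dx p := by
  rw [Derivation.leibniz, Dx_C, smul_zero, add_zero, smul_eq_mul]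

theorem C_mul_self_eq_one {ε : ℝ} (hε : ε = 1 ∨ ε = -1) : (C ε * C ε : PP) = 1 := by
  rw [← C_mul, mul_self_eq_one_iff.mpr hε, C_1]

namespace LVF

theorem phi_NLIE (a ε₁ c : ℝ) (hε₁ : ε₁ = 1 ∨ ε₁ = -1) :
    phi a ε₁ (NLIE a ε₁ c) = C (a ^ 2 * c) * k1 := by
  simp only [phi, NLIE, map_zero, C_mul, C_pow, map_ofNat]
  linear_combination 2 * C a ^ 2 * C c * k1 * C_mul_self_eq_one hε₁

theorem psi_NLIE (a ε₁ ε₂ c : ℝ) :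
    psi ε₂ (NLIE a ε₁ c) = C (-(2 * ε₁ * ε₂ * a ^ 2 * c)) * k2 := by
  simp only [psi, NLIE, map_zero, C_neg, C_mul, C_pow, map_ofNat]
  ring

theorem rho_NLIE (a ε₁ c : ℝ) (hε₁ : ε₁ = 1 ∨ ε₁ = -1) :
    rho a ε₁ (NLIE a ε₁ c) = 0 := by
  rw [rho, phi_NLIE a ε₁ c hε₁]
  simp only [NLIE, neg_mul, map_neg, Dx_C, Dx_C_mul]
  simp only [C_mul, C_pow]
  ring

theorem vhat_k1 (a ε₁ ε₂ G : ℝ) (V : LVF) : vhat a ε₁ ε₂ G V k1 = vk1 a ε₁ ε₂ G V := by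
  simp [vhat, k1, vhatFun]

theorem vhat_k2 (a ε₁ ε₂ G : ℝ) (V : LVF) : vhat a ε₁ ε₂ G V k2 = vk2 a ε₁ ε₂ G V := by
  simp [vhat, k2, vhatFun]

end LVF

open LVF in
/-- The NLIE field lies in `𝔛*`, preserves pseudo arc-length, and its
curvature flow is the (rescaled) Hirota–Satsuma coupled KdV system (case `G = 0`). -/
theorem stmt19 (a ε₁ ε₂ c : ℝ) (ha : a ≠ 0) (hε₁ : ε₁ = 1 ∨ ε₁ = -1)
    (hε₂ : ε₂ = 1 ∨ ε₂ = -1) :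
    isStar a ε₁ (NLIE a ε₁ c) ∧ rho a ε₁ (NLIE a ε₁ c) = 0 ∧
    vhat a ε₁ ε₂ 0 (NLIE a ε₁ c) k1 =
      MvPolynomial.C c * (Dx (Dx (Dx k1)) + MvPolynomial.C (3 * a) * k1 * Dx k1
        + MvPolynomial.C (6 * ε₁ * ε₂ * a) * k2 * Dx k2) ∧
    vhat a ε₁ ε₂ 0 (NLIE a ε₁ c) k2 =
      - MvPolynomial.C c * (2 * Dx (Dx (Dx k2)) + MvPolynomial.C (3 * a) * k1 * Dx k2) := by
  have h₁ := C_mul_self_eq_one hε₁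
  have h₂ := C_mul_self_eq_one hε₂
  have hinv : (C a⁻¹ * C a : PP) = 1 := by rw [← C_mul, inv_mul_cancel₀ ha, C_1]
  have hinv_sq : (C a⁻¹ ^ 2 * C a ^ 2 : PP) = 1 := by rw [← mul_pow, hinv, one_pow]
  refine ⟨?_, rho_NLIE a ε₁ c hε₁, ?_, ?_⟩
  · simp [isStar, NLIE]
  · rw [vhat_k1, vk1, phi_NLIE a ε₁ c hε₁, psi_NLIE, rho_NLIE a ε₁ c hε₁]
    simp only [Dx_C, Derivation.leibniz, smul_eq_mul, map_zero, mul_zero, zero_mul,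
      add_zero, NLIE]
    simp only [div_eq_mul_inv, one_mul, ← inv_pow, C_neg, C_mul, C_pow, map_ofNat]
    linear_combination C c * Dx (Dx (Dx k1)) * hinv_sq
      + (3 * C a * C c * k1 * Dx k1 + 6 * C ε₁ * C ε₂ * C a * C c * k2 * Dx k2) * hinv
  · rw [vhat_k2, vk2, phi_NLIE a ε₁ c hε₁, psi_NLIE, rho_NLIE a ε₁ c hε₁]
    simp only [Dx_C, Derivation.leibniz, smul_eq_mul, map_zero, mul_zero,
      add_zero, NLIE]
    simp only [div_eq_mul_inv, one_mul, ← inv_pow, C_neg, C_mul, C_pow, map_ofNat]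
    have h₁₂ : (C ε₁ * C ε₁ * (C ε₂ * C ε₂) : PP) = 1 := by rw [h₁, h₂, one_mul]
    linear_combination
      (-2 * C c * C a⁻¹ ^ 2 * C a ^ 2 * Dx (Dx (Dx k2))
        - 2 * C a⁻¹ * C a ^ 2 * C c * (k2 * Dx k1 + 2 * k1 * Dx k2)) * h₁₂
      - 2 * C c * Dx (Dx (Dx k2)) * hinv_sq
      - 3 * C a * C c * k1 * Dx k2 * hinv
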